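/- arXiv:1208.0508 — 2 statements merged into one kernel-verified Lean document; each statement's English description precedes it below -/
import Mathlib

section
/- Let q = p^e be a prime power with q ≡ 1 (mod 4), and let E_2: y² = x³ + fx² + gx be an elliptic curve over F_q with f ≠ 0. If T is a generator of the character group of F_q^×, then a_q(E_2) = −q·T^{(q-1)/2}(2f)·T^{(q-1)/4}(−1) · ₂F₁(T^{(q-1)/4}, T^{3(q-1)/4}; ε | 4g/f²), where ε is the trivial character. -/
open Finset Complex

/-- The root of unity `e^{2πi/p}`. -/
noncomputable def zetaP (p : ℕ) : ℂ := Complex.exp (2 * Real.pi * Complex.I / p)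

lemma zetaP_pow (p : ℕ) (hp : p ≠ 0) : zetaP p ^ p = 1 := by
  rw [zetaP, ← Complex.exp_nat_mul]
  have : (p : ℂ) * (2 * Real.pi * Complex.I / p) = 2 * Real.pi * Complex.I := by
    rw [mul_div_assoc']
    exact mul_div_cancel_left₀ _ (by exact_mod_cast hp)
  rw [this, Complex.exp_two_pi_mul_I]

/-- The canonical additive character `θ(α) = ζ_p^{tr α}` of a finite field of
characteristic `p`. -/
noncomputable def theta (p : ℕ) [hp : Fact p.Prime] (F : Type*) [Field F] [Fintype F]
    [Algebra (ZMod p) F] : AddChar F ℂ :=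
  (AddChar.zmodChar p (zetaP_pow p hp.out.ne_zero)).compAddMonoidHom
    (Algebra.trace (ZMod p) F).toAddMonoidHom

/-- Gauss sum `G_m = G(T^m)` with respect to the canonical additive character. -/
noncomputable def GG (p : ℕ) [Fact p.Prime] {F : Type*} [Field F] [Fintype F]
    [Algebra (ZMod p) F] (T : MulChar F ℂ) (m : ℤ) : ℂ :=
  gaussSum (T ^ m) (theta p F)

/-- Greene's binomial coefficient `binom(A,B) = (B(-1)/q) J(A, B⁻¹)`. -/
noncomputable def greeneBinom (F : Type*) [Field F] [Fintype F] (A B : MulChar F ℂ) : ℂ :=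
  B (-1) / (Fintype.card F : ℂ) * ∑ x : F, A x * B⁻¹ (1 - x)

/-- Greene's hypergeometric series `₂F₁(A,B;C|x)`, with the sum over all characters
written as a sum over the powers of a generator `T` of the character group. -/
noncomputable def hyp2F1 {F : Type*} [Field F] [Fintype F] (T A B C : MulChar F ℂ) (x : F) : ℂ :=
  (Fintype.card F : ℂ) / ((Fintype.card F : ℂ) - 1) *
    ∑ n ∈ Finset.range (Fintype.card F - 1),
      greeneBinom F (A * T ^ n) (T ^ n) * greeneBinom F (B * T ^ n) (C * T ^ n) * (T ^ n) x

section helpers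

open Classical in
lemma fiber_sum {F : Type*} [Fintype F] (G : F → F) (w H : F → ℂ) :
    ∑ x, w x * H (G x) = ∑ c, H c * ∑ x, (if G x = c then w x else 0) := by
  simp_rw [Finset.mul_sum]
  rw [Finset.sum_comm]
  refine Finset.sum_congr rfl fun x _ => ?_
  simp [mul_comm]

open Classical in
/-- number of roots of a quadratic -/
lemma quad_count {F : Type*} [Field F] [Fintype F] (h2 : (2 : F) ≠ 0) (φ : MulChar F ℂ)
    (hc : ∀ a : F, ∑ y : F, (if y ^ 2 = a then (1 : ℂ) else 0) = 1 + φ a)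
    (α β γ : F) (hα : α ≠ 0) :
    ∑ x : F, (if α * x ^ 2 + β * x + γ = 0 then (1 : ℂ) else 0) = 1 + φ (β ^ 2 - 4 * α * γ) := by
  rw [← hc]
  have h2α : 2 * α ≠ 0 := mul_ne_zero h2 hα
  refine Fintype.sum_equiv ((Equiv.mulLeft₀ (2 * α) h2α).trans (Equiv.addRight β)) _ _ fun x => ?_
  have : (α * x ^ 2 + β * x + γ = 0) ↔ ((2 * α * x + β) ^ 2 = β ^ 2 - 4 * α * γ) := by
    constructor
    · intro h; linear_combination 4 * α * h
    · intro h
      have h4 : (2 * (2 * α)) * (α * x ^ 2 + β * x + γ) = 0 := by linear_combination h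
      exact (mul_eq_zero.mp h4).resolve_left (mul_ne_zero h2 h2α)
  simp [this]

/-- squares vanish -/
lemma phi_sq {F : Type*} [Field F] (φ : MulChar F ℂ) (hs : ∀ a : F, a ≠ 0 → φ a * φ a = 1)
    (a b : F) (ha : a ≠ 0) : φ (a ^ 2 * b) = φ b := by
  rw [map_mul, pow_two, map_mul, hs a ha, one_mul]

lemma phi_inv {F : Type*} [Field F] (φ : MulChar F ℂ) (hs : ∀ a : F, a ≠ 0 → φ a * φ a = 1)
    (a : F) : φ a⁻¹ = φ a := by
  rcases eq_or_ne a 0 with rfl | ha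
  · simp [MulChar.map_zero]
  · rw [← phi_sq φ hs a a⁻¹ ha]; congr 1; field_simp

lemma phi_sum {F : Type*} [Field F] [Fintype F] (φ : MulChar F ℂ) (h1 : φ ≠ 1) (a : F) :
    ∑ x, φ (x + a) = 0 := by
  rw [← MulChar.sum_eq_zero_of_ne_one h1]
  exact Fintype.sum_equiv (Equiv.addRight a) _ _ fun x => rfl

/-- the 2-isogeny step -/
lemma step_isog {F : Type*} [Field F] [Fintype F] (h2 : (2 : F) ≠ 0) (φ : MulChar F ℂ)
    (h1 : φ ≠ 1) (hs : ∀ a : F, a ≠ 0 → φ a * φ a = 1)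
    (hc : ∀ a : F, (∑ y : F, (open Classical in if y ^ 2 = a then (1 : ℂ) else 0)) = 1 + φ a)
    (X : F) (hX : X ≠ 0) :
    ∑ w, φ (w * (w ^ 2 + 2 * w + X)) = ∑ m, φ (m + 2) * φ (m ^ 2 - 4 * X) := by
  classical
  have e1 : ∀ w : F, φ (w * (w ^ 2 + 2 * w + X)) =
      (if w = 0 then (0 : ℂ) else 1) * φ ((w + X / w) + 2) := by
    intro w
    rcases eq_or_ne w 0 with rfl | hw
    · simp [MulChar.map_zero]
    · simp only [hw, if_false, one_mul]
      rw [← phi_sq φ hs w (w + X / w + 2) hw]; congr 1; field_simp; ring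
  simp_rw [e1]
  rw [fiber_sum (fun w => w + X / w) _ (fun m => φ (m + 2))]
  have e2 : ∀ m : F, (∑ x : F, if x + X / x = m then (if x = 0 then (0 : ℂ) else 1) else 0) =
      1 + φ (m ^ 2 - 4 * X) := by
    intro m
    have := quad_count h2 φ (by simpa using hc) 1 (-m) X one_ne_zero
    rw [show m ^ 2 - 4 * X = (-m) ^ 2 - 4 * 1 * X by ring, ← this]
    refine Finset.sum_congr rfl fun x _ => ?_
    rcases eq_or_ne x 0 with rfl | hx
    · simp [hX]
    · have : x + X / x = m ↔ 1 * x ^ 2 + -m * x + X = 0 := by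
        field_simp
        constructor <;> intro h <;> linear_combination h
      simp [this, hx]
  simp_rw [e2, mul_add, mul_one, Finset.sum_add_distrib]
  rw [phi_sum φ h1, zero_add]

lemma step_d {F : Type*} [Field F] [Fintype F] (h2 : (2 : F) ≠ 0) (φ : MulChar F ℂ)
    (hs : ∀ a : F, a ≠ 0 → φ a * φ a = 1) (hm : φ (-1) = 1)
    (hc : ∀ a : F, (∑ y : F, (open Classical in if y ^ 2 = a then (1 : ℂ) else 0)) = 1 + φ a)
    (X : F) :
    ∑ d, φ d * φ ((d ^ 2) ^ 2 + (2 - 4 * X) * d ^ 2 + 1) =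
      2 * ∑ m, φ (m + 2) * φ (m ^ 2 - 4 * X) := by
  classical
  have e1 : ∀ d : F, φ d * φ ((d ^ 2) ^ 2 + (2 - 4 * X) * d ^ 2 + 1) =
      φ d * φ ((d + 1 / d) ^ 2 - 4 * X) := by
    intro d
    rcases eq_or_ne d 0 with rfl | hd
    · simp [MulChar.map_zero]
    · rw [← phi_sq φ hs d ((d + 1 / d) ^ 2 - 4 * X) hd]; congr 2; field_simp; ring
  simp_rw [e1]
  rw [fiber_sum (fun d => d + 1 / d) (fun d => φ d) (fun m => φ (m ^ 2 - 4 * X))]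
  have e2 : ∀ m : F, (∑ x : F, if x + 1 / x = m then φ x else 0) = φ (m + 2) + φ (m - 2) := by
    intro m
    have iff : ∀ x : F, x ≠ 0 → (x + 1 / x = m ↔ 1 * x ^ 2 + -m * x + 1 = 0) := by
      intro x hx
      field_simp
      constructor <;> intro h <;> linear_combination h
    rcases eq_or_ne (m + 2) 0 with hm2 | hm2
    · have hm' : m = -2 := by linear_combination hm2
      subst hm'
      rw [Finset.sum_eq_single (-1)]
      · have h4 : (-2 - 2 : F) = 2 ^ 2 * (-1) := by ring
        rw [h4, phi_sq φ hs 2 _ h2, if_pos (by norm_num)]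
        simp [MulChar.map_zero, hm]
      · intro x _ hx
        rcases eq_or_ne x 0 with rfl | hx0
        · simp [MulChar.map_zero]
        · rw [if_neg]
          rw [iff x hx0]
          intro h
          have : (x + 1) ^ 2 = 0 := by linear_combination h
          exact hx (by linear_combination pow_eq_zero_iff (two_ne_zero) |>.mp this)
      · simp [MulChar.map_zero]
    · have h3 : ∀ x : F, (if x + 1 / x = m then φ x else 0) =
          φ (m + 2) * (if 1 * x ^ 2 + -m * x + 1 = 0 then 1 else 0) := by
        intro x
        rcases eq_or_ne x 0 with rfl | hx0
        · simp [MulChar.map_zero]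
        · by_cases h : x + 1 / x = m
          · rw [if_pos h, if_pos ((iff x hx0).mp h), mul_one]
            have hx1 : x + 1 ≠ 0 := by
              intro hx
              apply hm2
              have : x = -1 := by linear_combination hx
              rw [← h, this]; norm_num
            rw [← phi_inv φ hs x, ← phi_sq φ hs (x + 1) _ hx1]
            congr 1; rw [← h]; field_simp; ring
          · rw [if_neg h, if_neg (fun h' => h ((iff x hx0).mpr h')), mul_zero]
      simp_rw [h3]
      rw [← Finset.mul_sum, quad_count h2 φ (by simpa using hc) 1 (-m) 1 one_ne_zero,
        show (-m) ^ 2 - 4 * 1 * 1 = (m + 2) * (m - 2) by ring, map_mul, mul_add, ← mul_assoc,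
        hs _ hm2]
      ring
  simp_rw [e2, mul_add, Finset.sum_add_distrib]
  have e3 : ∑ m, φ (m ^ 2 - 4 * X) * φ (m - 2) = ∑ m, φ (m ^ 2 - 4 * X) * φ (m + 2) := by
    refine Fintype.sum_equiv (Equiv.neg F) _ _ fun m => ?_
    simp only [Equiv.neg_apply, neg_sq]
    rw [show m - 2 = (-1) * (-m + 2) by ring, map_mul φ (-1), hm, one_mul]
  rw [e3, two_mul]
  simp_rw [mul_comm]

lemma step_psi {F : Type*} [Field F] [Fintype F] (h2 : (2 : F) ≠ 0) (φ ψ : MulChar F ℂ)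
    (hs : ∀ a : F, a ≠ 0 → φ a * φ a = 1) (hm : φ (-1) = 1)
    (hc : ∀ a : F, (∑ y : F, (open Classical in if y ^ 2 = a then (1 : ℂ) else 0)) = 1 + φ a)
    (hψ : ∀ a, ψ a * ψ a = φ a) (X : F) :
    ∑ c, ψ c * φ (c ^ 2 + (2 - 4 * X) * c + 1) = ∑ m, φ (m + 2) * φ (m ^ 2 - 4 * X) := by
  classical
  have e0 : ∑ c, ψ c * φ (c ^ 2 + (2 - 4 * X) * c + 1) =
      ∑ c, ψ c⁻¹ * φ (c ^ 2 + (2 - 4 * X) * c + 1) := by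
    refine Fintype.sum_equiv (inv_involutive.toPerm (Inv.inv : F → F)) _ _ fun c => ?_
    simp only [Function.Involutive.coe_toPerm, inv_inv]
    rcases eq_or_ne c 0 with rfl | h
    · simp [MulChar.map_zero]
    · congr 1
      rw [← phi_sq φ hs c ((c⁻¹) ^ 2 + (2 - 4 * X) * c⁻¹ + 1) h]; congr 1; field_simp; ring
  have e1 : ∀ c : F, (∑ d : F, if d ^ 2 = c then φ d else 0) = ψ c + ψ c⁻¹ := by
    intro c
    by_cases hsq : ∃ e, e ^ 2 = c
    · obtain ⟨e, rfl⟩ := hsq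
      rcases eq_or_ne e 0 with rfl | he
      · simp [MulChar.map_zero]
      · have h3 : ∀ d : F, (if d ^ 2 = e ^ 2 then φ d else 0) =
            φ e * (if d ^ 2 = e ^ 2 then 1 else 0) := by
          intro d
          split_ifs with h
          · rcases sq_eq_sq_iff_eq_or_eq_neg.mp h with rfl | rfl
            · simp [MulChar.map_zero]
            · rw [neg_eq_neg_one_mul, map_mul, hm]; simp
          · simp [MulChar.map_zero]
        simp_rw [h3]
        rw [← Finset.mul_sum, hc, ← mul_one (e ^ 2), phi_sq φ hs e 1 he, map_one, mul_one,
          ← inv_pow, pow_two, map_mul, hψ, pow_two, map_mul, hψ, phi_inv φ hs]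
        ring
    · have hc0 : c ≠ 0 := fun h => hsq ⟨0, by simp [h]⟩
      have h0 : ∀ d : F, ¬ d ^ 2 = c := fun d hd => hsq ⟨d, hd⟩
      have := hc c
      simp only [h0, if_false, Finset.sum_const_zero] at this ⊢
      have hψ1 : ψ c * ψ c⁻¹ = 1 := by rw [← map_mul, mul_inv_cancel₀ hc0, map_one]
      have hψ2 := hψ c
      have hne : ψ c ≠ 0 := left_ne_zero_of_mul_eq_one hψ1
      apply mul_left_cancel₀ hne
      linear_combination this - hψ1 - hψ2
  have e2 : ∑ d, φ d * φ ((d ^ 2) ^ 2 + (2 - 4 * X) * d ^ 2 + 1) =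
      ∑ c, ψ c * φ (c ^ 2 + (2 - 4 * X) * c + 1) + ∑ c, ψ c⁻¹ * φ (c ^ 2 + (2 - 4 * X) * c + 1) := by
    rw [fiber_sum (fun d => d ^ 2) (fun d => φ d) (fun c => φ (c ^ 2 + (2 - 4 * X) * c + 1)),
      ← Finset.sum_add_distrib]
    refine Finset.sum_congr rfl fun c _ => ?_
    rw [e1]; ring
  rw [step_d h2 φ hs hm hc X, ← e0] at e2
  linear_combination -e2 / 2

lemma step_u {F : Type*} [Field F] [Fintype F] (h2 : (2 : F) ≠ 0) (φ ψ : MulChar F ℂ)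
    (h1 : ψ ≠ 1)
    (hc : ∀ a : F, (∑ y : F, (open Classical in if y ^ 2 = a then (1 : ℂ) else 0)) = 1 + φ a)
    (X : F) (hX : X ≠ 0) (hX1 : X ≠ 1) :
    ∑ u, ψ (u * (X * u + 1 - u) / (1 - u)) =
      ψ (-1) * ∑ c, ψ c * φ (c ^ 2 + (2 - 4 * X) * c + 1) := by
  classical
  have := fiber_sum (fun u : F => u * (X * u + 1 - u) / (1 - u)) (fun _ => 1) (fun c => ψ c)
  simp only [one_mul] at this
  rw [this]
  have e1 : ∀ c : F, ψ c * (∑ u : F, if u * (X * u + 1 - u) / (1 - u) = c then (1 : ℂ) else 0) =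
      ψ c + ψ c * φ (c ^ 2 + (4 * X - 2) * c + 1) := by
    intro c
    rcases eq_or_ne c 0 with rfl | h0
    · simp [MulChar.map_zero]
    · rw [show c ^ 2 + (4 * X - 2) * c + 1 = (1 + c) ^ 2 - 4 * (X - 1) * (-c) by ring]
      have hq := quad_count h2 φ (by simpa using hc) (X - 1) (1 + c) (-c) (sub_ne_zero.mpr hX1)
      have : ∀ u : F, u * (X * u + 1 - u) / (1 - u) = c ↔
          (X - 1) * u ^ 2 + (1 + c) * u + -c = 0 := by
        intro u
        rcases eq_or_ne u 1 with rfl | hu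
        · constructor
          · intro h; simp at h; exact absurd h.symm h0
          · intro h; exact absurd (by linear_combination h) hX
        · rw [div_eq_iff (sub_ne_zero.mpr hu.symm)]
          constructor <;> intro h <;> linear_combination h
      simp_rw [this]
      rw [hq]; ring
  simp_rw [e1]
  rw [Finset.sum_add_distrib, MulChar.sum_eq_zero_of_ne_one h1, zero_add, Finset.mul_sum]
  refine Fintype.sum_equiv (Equiv.neg F) _ _ fun c => ?_
  simp only [Equiv.neg_apply]
  rw [← mul_assoc, ← map_mul]
  congr 2 <;> ring

lemma orth {F : Type*} [Field F] [Fintype F] (T : MulChar F ℂ)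
    (hT : ∀ χ : MulChar F ℂ, ∃ n : ℕ, χ = T ^ n) (y : F) :
    ∑ n ∈ Finset.range (Fintype.card F - 1), (T ^ n) y =
      (open Classical in if y = 1 then ((Fintype.card F : ℂ) - 1) else 0) := by
  classical
  have hq : 1 < Fintype.card F := Fintype.one_lt_card
  rcases eq_or_ne y 0 with rfl | hy
  · simp [MulChar.map_zero]
  · have hp : ∀ n : ℕ, (T ^ n) y = T y ^ n := fun n => MulChar.pow_apply_coe T n (Units.mk0 y hy)
    simp_rw [hp]
    split_ifs with h
    · subst h
      simp [Nat.cast_sub hq.le]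
    · have hne : T y ≠ 1 := by
        intro h1
        obtain ⟨χ, hχ⟩ := MulChar.exists_apply_ne_one_of_hasEnoughRootsOfUnity F ℂ h
        obtain ⟨n, rfl⟩ := hT χ
        exact hχ (by rw [hp, h1, one_pow])
      rw [geom_sum_eq hne, ← map_pow, FiniteField.pow_card_sub_one_eq_one y hy]
      simp

lemma hyp_eq {F : Type*} [Field F] [Fintype F] (T : MulChar F ℂ)
    (hT : ∀ χ : MulChar F ℂ, ∃ n : ℕ, χ = T ^ n) (ψ : MulChar F ℂ) (X : F) (hX : X ≠ 0) :
    (Fintype.card F : ℂ) * hyp2F1 T ψ ψ⁻¹ 1 X =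
      ∑ u, ψ (u * (X * u + 1 - u) / (1 - u)) := by
  classical
  have hq : 1 < Fintype.card F := Fintype.one_lt_card
  have hq0 : (Fintype.card F : ℂ) ≠ 0 := by exact_mod_cast (by omega : Fintype.card F ≠ 0)
  have hq1 : (Fintype.card F : ℂ) - 1 ≠ 0 := by
    rw [sub_ne_zero]; exact_mod_cast (by omega : Fintype.card F ≠ 1)
  have hb : ∀ (A χ : MulChar F ℂ), greeneBinom F (A * χ) χ =
      (1 / (Fintype.card F : ℂ)) * ∑ u, A u * χ (-u / (1 - u)) := by
    intro A χ
    rw [greeneBinom, Finset.mul_sum, Finset.mul_sum]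
    refine Finset.sum_congr rfl fun u _ => ?_
    rw [MulChar.inv_apply', MulChar.mul_apply, div_eq_mul_inv (-u), map_mul, neg_eq_neg_one_mul u,
      map_mul]
    ring
  have ht : ∀ n : ℕ, greeneBinom F (ψ * T ^ n) (T ^ n) *
      greeneBinom F (ψ⁻¹ * T ^ n) (1 * T ^ n) * (T ^ n) X =
      (1 / (Fintype.card F : ℂ)) ^ 2 *
        ∑ u, ∑ v, ψ u * ψ⁻¹ v * (T ^ n) (-u / (1 - u) * (-v / (1 - v)) * X) := by
    intro n
    rw [one_mul, hb, hb]
    have : ∑ u, ∑ v, ψ u * ψ⁻¹ v * (T ^ n) (-u / (1 - u) * (-v / (1 - v)) * X) =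
      (∑ u, ψ u * (T ^ n) (-u / (1 - u))) * (∑ v, ψ⁻¹ v * (T ^ n) (-v / (1 - v))) * (T ^ n) X := by
      rw [Finset.sum_mul_sum, Finset.sum_mul]
      refine Finset.sum_congr rfl fun u _ => ?_
      rw [Finset.sum_mul]
      refine Finset.sum_congr rfl fun v _ => ?_
      rw [map_mul, map_mul]; ring
    rw [this]; ring
  rw [hyp2F1]
  simp_rw [ht]
  rw [← Finset.mul_sum, Finset.sum_comm]
  have e : ∀ u : F, ∑ n ∈ Finset.range (Fintype.card F - 1),
      ∑ v, ψ u * ψ⁻¹ v * (T ^ n) (-u / (1 - u) * (-v / (1 - v)) * X) =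
      ((Fintype.card F : ℂ) - 1) * ψ (u * (X * u + 1 - u) / (1 - u)) := by
    intro u
    rw [Finset.sum_comm]
    simp_rw [← Finset.mul_sum, orth T hT]
    rcases eq_or_ne u 0 with rfl | hu
    · simp [MulChar.map_zero]
    rcases eq_or_ne u 1 with rfl | hu1
    · simp [MulChar.map_zero]
    have hu1' : 1 - u ≠ 0 := sub_ne_zero.mpr hu1.symm
    have iff : ∀ v : F, v ≠ 0 → (-u / (1 - u) * (-v / (1 - v)) * X = 1 ↔
        v * (X * u + 1 - u) = 1 - u) := by
      intro v hv
      rcases eq_or_ne v 1 with rfl | hv1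
      · simp only [sub_self, div_zero, mul_zero, zero_mul, one_mul]
        constructor
        · intro h; exact absurd h zero_ne_one
        · intro h
          exact absurd (by linear_combination h : X * u = 0) (mul_ne_zero hX hu)
      · have hv1' : 1 - v ≠ 0 := sub_ne_zero.mpr hv1.symm
        rw [div_mul_div_comm, div_mul_eq_mul_div, div_eq_one_iff_eq (mul_ne_zero hu1' hv1')]
        constructor <;> intro h <;> linear_combination h
    by_cases hk : X * u + 1 - u = 0
    · rw [hk, mul_zero, zero_div, MulChar.map_zero, mul_zero]
      refine Finset.sum_eq_zero fun v _ => ?_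
      rcases eq_or_ne v 0 with rfl | hv
      · simp [MulChar.map_zero]
      · rw [if_neg, mul_zero]
        rw [iff v hv, hk, mul_zero]
        exact fun h => hu1' h.symm
    · rw [Finset.sum_eq_single ((1 - u) / (X * u + 1 - u))]
      · rw [if_pos ((iff _ (div_ne_zero hu1' hk)).mpr (div_mul_cancel₀ _ hk)), MulChar.inv_apply',
          ← map_mul, inv_div, mul_comm, mul_div_assoc]
      · intro v _ hv
        rcases eq_or_ne v 0 with rfl | hv0
        · simp [MulChar.map_zero]
        · rw [if_neg, mul_zero]
          rw [iff v hv0]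
          intro h
          exact hv ((eq_div_iff hk).mpr h)
      · simp [MulChar.map_zero]
  simp_rw [e]
  rw [← Finset.mul_sum]
  generalize ∑ u, ψ (u * (X * u + 1 - u) / (1 - u)) = S
  field_simp

lemma curve_count {F : Type*} [Field F] [Fintype F] (φ : MulChar F ℂ)
    (hc : ∀ a : F, (∑ y : F, (open Classical in if y ^ 2 = a then (1 : ℂ) else 0)) = 1 + φ a)
    (f g : F) :
    (Nat.card {s : F × F // s.2 ^ 2 = s.1 ^ 3 + f * s.1 ^ 2 + g * s.1} : ℂ) =
      Fintype.card F + ∑ x, φ (x ^ 3 + f * x ^ 2 + g * x) := by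
  classical
  rw [Nat.card_eq_fintype_card, Fintype.card_subtype, Finset.card_filter]
  push_cast
  rw [Fintype.sum_prod_type]
  simp only
  have := fun x : F => hc (x ^ 3 + f * x ^ 2 + g * x)
  rw [Finset.sum_congr rfl fun x _ => this x]
  rw [Finset.sum_add_distrib]
  simp

lemma order_T {F : Type*} [Field F] [Fintype F] (T : MulChar F ℂ)
    (hT : ∀ χ : MulChar F ℂ, ∃ n : ℕ, χ = T ^ n) : orderOf T = Fintype.card F - 1 := by
  classical
  have h := orderOf_eq_card_of_forall_mem_powers (g := T)
    (fun χ => by obtain ⟨n, hn⟩ := hT χ; exact ⟨n, hn.symm⟩)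
  rw [h, MulChar.card_eq_card_units_of_hasEnoughRootsOfUnity, Nat.card_eq_fintype_card,
    Fintype.card_units]

lemma phi_eq {F : Type*} [Field F] [Fintype F] [DecidableEq F] (hF : ringChar F ≠ 2)
    (k : ℕ) (hk : Fintype.card F - 1 = 2 * k) (hk0 : k ≠ 0)
    (T : MulChar F ℂ)
    (hT : ∀ χ : MulChar F ℂ, ∃ n : ℕ, χ = T ^ n) :
    (quadraticChar F).ringHomComp (Int.castRingHom ℂ) = T ^ k := by
  obtain ⟨n, hn⟩ := hT ((quadraticChar F).ringHomComp (Int.castRingHom ℂ))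
  have ho := order_T T hT
  have h1 : (quadraticChar F).ringHomComp (Int.castRingHom ℂ) ≠ 1 := by
    rw [MulChar.ringHomComp_ne_one_iff (RingHom.injective_int _)]
    exact quadraticChar_ne_one hF
  have h2 : (T ^ n) ^ 2 = 1 := by
    rw [← hn]
    exact ((quadraticChar_isQuadratic F).comp _).sq_eq_one
  rw [← pow_mul, ← orderOf_dvd_iff_pow_eq_one, ho, hk, mul_comm n 2] at h2
  have h3 := Nat.dvd_of_mul_dvd_mul_left two_pos h2
  obtain ⟨j, rfl⟩ := h3
  rw [hn] at h1 ⊢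
  have hTk : T ^ (2 * k) = 1 := by rw [← hk, ← ho, pow_orderOf_eq_one]
  rcases Nat.even_or_odd' j with ⟨i, rfl | rfl⟩
  · exact absurd (by rw [show k * (2 * i) = 2 * k * i by ring, pow_mul, hTk, one_pow]) h1
  · rw [show k * (2 * i + 1) = 2 * k * i + k by ring, pow_add, pow_mul, hTk, one_pow, one_mul]

end helpers

theorem stmt7 {p : ℕ} [hp : Fact p.Prime] (hp2 : p ≠ 2) {F : Type*} [Field F] [Fintype F]
    [Algebra (ZMod p) F] (hq : Fintype.card F % 4 = 1) (f g : F) (hf : f ≠ 0)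
    (hns : g * (f ^ 2 - 4 * g) ≠ 0) (T : MulChar F ℂ) (hT : ∀ χ : MulChar F ℂ, ∃ n : ℕ, χ = T ^ n) :
    (Fintype.card F : ℂ) + 1 - ((Nat.card {s : F × F // s.2 ^ 2 = s.1 ^ 3 + f * s.1 ^ 2 + g * s.1} : ℂ) + 1) =
      -(Fintype.card F : ℂ) * (T ^ ((Fintype.card F - 1) / 2)) (2 * f) * (T ^ ((Fintype.card F - 1) / 4)) (-1) *
        hyp2F1 T (T ^ ((Fintype.card F - 1) / 4)) (T ^ ((3 * (Fintype.card F - 1)) / 4)) 1 (4 * g / f ^ 2) := by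
  classical
  have hcard : 1 < Fintype.card F := Fintype.one_lt_card
  obtain ⟨k, hk⟩ : ∃ k, Fintype.card F - 1 = 4 * k := ⟨(Fintype.card F - 1) / 4, by omega⟩
  have hk0 : k ≠ 0 := by omega
  have hF : ringChar F ≠ 2 := by
    intro h
    have := FiniteField.even_card_of_char_two h
    omega
  have h2 : (2 : F) ≠ 0 := Ring.two_ne_zero hF
  have ho := order_T T hT
  rw [show (Fintype.card F - 1) / 2 = 2 * k by omega, show (Fintype.card F - 1) / 4 = k by omega,
    show 3 * (Fintype.card F - 1) / 4 = 3 * k by omega]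
  have hT4 : T ^ (4 * k) = 1 := by rw [← hk, ← ho, pow_orderOf_eq_one]
  have hinv : T ^ (3 * k) = (T ^ k)⁻¹ := by
    rw [eq_inv_iff_mul_eq_one, ← pow_add, ← hT4]; congr 1; ring
  have hφ := phi_eq hF (2 * k) (by omega) (by omega) T hT
  have hne : ∀ j, 0 < j → j < 4 * k → T ^ j ≠ 1 := by
    intro j hj hj' h
    have := orderOf_le_of_pow_eq_one hj h
    omega
  set φ := T ^ (2 * k) with hφd
  set ψ := T ^ k with hψd
  have hφ1 : φ ≠ 1 := hne _ (by omega) (by omega)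
  have hψ1 : ψ ≠ 1 := hne _ (by omega) (by omega)
  have hψ : ∀ a, ψ a * ψ a = φ a := by
    intro a
    rw [← MulChar.mul_apply, hψd, hφd, ← pow_add, two_mul]
  have hs : ∀ a : F, a ≠ 0 → φ a * φ a = 1 := by
    intro a ha
    rw [← MulChar.mul_apply, hφd, ← pow_add, show 2 * k + 2 * k = 4 * k by ring, hT4,
      MulChar.one_apply ha.isUnit]
  have hψm : ψ (-1) * ψ (-1) = 1 := by rw [← map_mul]; simp
  have hm : φ (-1) = 1 := by rw [← hψ, hψm]
  have hc : ∀ a : F, ∑ y : F, (if y ^ 2 = a then (1 : ℂ) else 0) = 1 + φ a := by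
    intro a
    have := quadraticChar_card_sqrts hF a
    rw [← hφ, MulChar.ringHomComp_apply, add_comm, eq_intCast, ← Int.cast_one, ← Int.cast_add,
      ← this]
    simp
  have hg : g ≠ 0 := left_ne_zero_of_mul hns
  have hd : f ^ 2 - 4 * g ≠ 0 := right_ne_zero_of_mul hns
  set X := 4 * g / f ^ 2 with hXd
  have h4 : (4 : F) ≠ 0 := by
    rw [show (4 : F) = 2 * 2 by norm_num]; exact mul_ne_zero h2 h2
  have hX : X ≠ 0 := div_ne_zero (mul_ne_zero h4 hg) (pow_ne_zero 2 hf)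
  have hX1 : X ≠ 1 := by
    intro h
    rw [hXd, div_eq_one_iff_eq (pow_ne_zero 2 hf)] at h
    exact hd (by rw [h, sub_self])
  have key := hyp_eq T hT ψ X hX
  rw [step_u h2 φ ψ hψ1 (by simpa using hc) X hX hX1,
    step_psi h2 φ ψ hs hm (by simpa using hc) hψ X,
    ← step_isog h2 φ hφ1 hs (by simpa using hc) X hX] at key
  have hcurve := curve_count φ (by simpa using hc) f g
  have hscale : ∑ x, φ (x ^ 3 + f * x ^ 2 + g * x) =
      φ (2 * f) * ∑ w, φ (w * (w ^ 2 + 2 * w + X)) := by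
    rw [Finset.mul_sum]
    symm
    refine Fintype.sum_equiv (Equiv.mulLeft₀ (f / 2) (div_ne_zero hf h2)) _ _ fun w => ?_
    rw [← map_mul, ← phi_sq φ hs (f / 4) _ (div_ne_zero hf h4)]
    simp only [Equiv.mulLeft₀_apply]
    congr 1
    rw [hXd, show (4 : F) = 2 * 2 by norm_num]
    field_simp
  rw [hcurve, hscale, hinv]
  linear_combination φ (2 * f) * ψ (-1) * key + φ (2 * f) * (∑ w, φ (w * (w ^ 2 + 2 * w + X))) * hψm
end

section
/- Let q ≡ 1 (mod 6), and let a, b ∈ F_q with a ≠ 0 such that −a/3 is a square in F_q, and let k satisfy 3k² + a = 0. Then the number of F_q-points (including infinity) on y² = x³ + ax + b equals q + 1 + q·T^{(q-1)/2}(−k)·₂F₁(T^{(q-1)/6}, T^{5(q-1)/6}; ε | −(k³+ak+b)/(4k³)), where T generates the character group of F_q^× and ε is the trivial character. -/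
open Finset Complex

/-- The quadratic character with complex values. -/
noncomputable def ph {F : Type*} [Field F] [Fintype F] [DecidableEq F] (x : F) : ℂ :=
  ((quadraticChar F x : ℤ) : ℂ)

section
set_option linter.unusedSectionVars false
variable {F : Type*} [Field F] [Fintype F] [DecidableEq F]

lemma ph_mul (x y : F) : ph (x * y) = ph x * ph y := by
  rw [ph, map_mul]
  push_cast
  rfl

lemma ph_sq (x : F) (hx : x ≠ 0) : ph (x ^ 2) = 1 := by
  simp [ph, quadraticChar_sq_one' hx]

lemma ph_sqrts (h2 : ringChar F ≠ 2) (a : F) :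
    ((univ.filter (fun y : F => y ^ 2 = a)).card : ℂ) = ph a + 1 := by
  have h := quadraticChar_card_sqrts h2 a
  have h' : ({x : F | x ^ 2 = a} : Set F).toFinset = univ.filter (fun y : F => y ^ 2 = a) := by
    ext; simp
  rw [h'] at h
  rw [ph]
  exact_mod_cast h

lemma quad_count_s16 (h2 : ringChar F ≠ 2) (α β γ : F) (hα : α ≠ 0) :
    ((univ.filter (fun y : F => α * y ^ 2 + β * y + γ = 0)).card : ℂ)
      = 1 + ph (β ^ 2 - 4 * α * γ) := by
  have two : (2 : F) ≠ 0 := Ring.two_ne_zero h2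
  rw [add_comm, ← ph_sqrts h2]
  congr 1
  refine Finset.card_bij' (fun y _ => 2 * α * y + β) (fun z _ => (z - β) / (2 * α)) ?_ ?_ ?_ ?_
  · intro y hy
    simp only [mem_filter, mem_univ, true_and] at hy ⊢
    linear_combination 4 * α * hy
  · intro z hz
    simp only [mem_filter, mem_univ, true_and] at hz ⊢
    field_simp
    linear_combination hz
  · intro y _
    field_simp
    ring
  · intro z _
    field_simp
    ring

/-- Summation over `v ≠ 0` of a function of `v + v⁻¹`. -/
lemma sum_add_inv (h2 : ringChar F ≠ 2) (h : F → ℂ) :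
    ∑ v ∈ univ.filter (fun v : F => v ≠ 0), h (v + v⁻¹)
      = ∑ s : F, h s * (1 + ph (s ^ 2 - 4)) := by
  rw [← Finset.sum_fiberwise _ (fun v : F => v + v⁻¹)]
  refine Finset.sum_congr rfl fun s _ => ?_
  rw [Finset.sum_congr rfl (g := fun _ => h s) (by
    intro v hv; rw [(mem_filter.1 hv).2])]
  rw [Finset.sum_const, nsmul_eq_mul, mul_comm]
  congr 1
  have := quad_count_s16 h2 (1 : F) (-s) 1 one_ne_zero
  rw [show (-s) ^ 2 - 4 * 1 * 1 = s ^ 2 - 4 by ring] at this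
  rw [← this]
  congr 2
  ext v
  simp only [mem_filter, mem_univ, true_and]
  constructor
  · rintro ⟨hv, hs⟩
    rw [← hs]; field_simp; ring
  · intro hv
    have hv0 : v ≠ 0 := by rintro rfl; simp at hv
    refine ⟨hv0, ?_⟩
    field_simp
    linear_combination hv

/-- The Chebyshev-type map permutes the `s` with `s² - 4` a nonsquare. -/
lemma cheb (h2 : ringChar F ≠ 2) (ζ : F) (hζ : ζ ^ 2 + ζ + 1 = 0) (g : F → ℂ) :
    ∑ s : F, g (s ^ 3 - 3 * s) * (1 - ph (s ^ 2 - 4)) = ∑ s : F, g s * (1 - ph (s ^ 2 - 4)) := by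
  have hm3 : IsSquare (-3 : F) := ⟨2 * ζ + 1, by linear_combination -4 * hζ⟩
  have two : (2 : F) ≠ 0 := Ring.two_ne_zero h2
  set M : Finset F := univ.filter (fun s : F => ¬ IsSquare (s ^ 2 - 4)) with hM
  have maps : ∀ s ∈ M, s ^ 3 - 3 * s ∈ M := by
    intro s hs
    simp only [hM, mem_filter, mem_univ, true_and] at hs ⊢
    rintro ⟨r, hr⟩
    by_cases h1 : s ^ 2 - 1 = 0
    · apply hs
      rw [show s ^ 2 - 4 = -3 by linear_combination h1]; exact hm3
    · apply hs
      refine ⟨r / (s ^ 2 - 1), ?_⟩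
      field_simp
      linear_combination hr
  have inj : ∀ s ∈ M, ∀ t ∈ M, s ^ 3 - 3 * s = t ^ 3 - 3 * t → s = t := by
    intro s hs t _ h
    by_contra hne
    simp only [hM, mem_filter, mem_univ, true_and] at hs
    apply hs
    have hne' : s - t ≠ 0 := sub_ne_zero.2 hne
    have e : s ^ 2 + s * t + t ^ 2 - 3 = 0 := by
      apply mul_left_cancel₀ hne'
      linear_combination h
    obtain ⟨d, hd⟩ := hm3
    by_cases hd0 : d = 0
    · have h3 : (3 : F) = 0 := by rw [hd0] at hd; linear_combination -hd
      exact ⟨s + 1 , by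
        have : (2 * t + s) ^ 2 = 0 := by linear_combination 4 * e + (4 - s ^ 2) * h3
        have ht : 2 * t + s = 0 := by simpa using this
        have e2 : (s - t) ^ 2 = 0 := by linear_combination e + (1 - s * t) * h3
        have : s - t = 0 := by simpa using e2
        exact absurd this hne'⟩
    · refine ⟨(2 * t + s) / d, ?_⟩
      field_simp
      linear_combination -4 * e - (s ^ 2 - 4) * hd
  have key : ∑ s ∈ M, g (s ^ 3 - 3 * s) = ∑ s ∈ M, g s := by
    have him : M.image (fun s => s ^ 3 - 3 * s) = M := by
      apply Finset.eq_of_subset_of_card_le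
      · intro x hx
        obtain ⟨s, hs, rfl⟩ := mem_image.1 hx
        exact maps s hs
      · rw [Finset.card_image_of_injOn (fun s hs t ht h => inj s hs t ht h)]
    conv_rhs => rw [← him]
    rw [Finset.sum_image (fun s hs t ht h => inj s hs t ht h)]
  have val : ∀ s : F, (1 - ph (s ^ 2 - 4)) = (if s ∈ M then 2 else 0) +
      (if s ^ 2 - 4 = 0 then 1 else 0) := by
    intro s
    simp only [hM, mem_filter, mem_univ, true_and]
    by_cases h0 : s ^ 2 - 4 = 0
    · simp [h0, ph]
    · by_cases h1 : IsSquare (s ^ 2 - 4)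
      · have := (quadraticChar_one_iff_isSquare h0).2 h1
        simp [h0, h1, ph, this]
      · have := quadraticChar_neg_one_iff_not_isSquare.2 h1
        simp [h0, h1, ph, this]; norm_num
  simp only [val, mul_add, Finset.sum_add_distrib, mul_ite, mul_zero, mul_one]
  congr 1
  · rw [Finset.sum_ite_mem, Finset.sum_ite_mem, univ_inter, ← Finset.sum_mul, ← Finset.sum_mul, key]
  · refine Finset.sum_congr rfl fun s _ => ?_
    split_ifs with h
    · congr 1; linear_combination s * h
    · rfl

lemma T_inj (T : MulChar F ℂ) (hT : ∀ χ : MulChar F ℂ, ∃ n : ℕ, χ = T ^ n) (x : F)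
    (hx : T x = 1) : x = 1 := by
  by_contra hne
  obtain ⟨χ, hχ⟩ := MulChar.exists_apply_ne_one_of_hasEnoughRootsOfUnity F ℂ hne
  obtain ⟨n, rfl⟩ := hT χ
  apply hχ
  have hu : IsUnit x := by
    by_contra h
    rw [T.map_nonunit h] at hx
    exact zero_ne_one hx
  obtain ⟨u, rfl⟩ := hu
  simp [MulChar.pow_apply_coe, hx]

lemma T_pow (T : MulChar F ℂ) (n : ℕ) (x : F) (hx : x ≠ 0) : (T ^ n) x = T x ^ n := by
  obtain ⟨u, rfl⟩ := (isUnit_iff_ne_zero.2 hx)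
  simp [MulChar.pow_apply_coe]

lemma T_zero (T : MulChar F ℂ) : T 0 = 0 := MulChar.map_nonunit _ (by simp)

lemma T_orth (T : MulChar F ℂ) (hT : ∀ χ : MulChar F ℂ, ∃ n : ℕ, χ = T ^ n) (z : F) :
    ∑ n ∈ range (Fintype.card F - 1), (T ^ n) z
      = if z = 1 then ((Fintype.card F : ℂ) - 1) else 0 := by
  by_cases h0 : z = 0
  · subst h0; simp [T_zero]
  simp only [T_pow T _ z h0]
  split_ifs with h
  · subst h
    have : 1 ≤ Fintype.card F := Fintype.card_pos
    simp [Nat.cast_sub this]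
  · have h1 : T z ≠ 1 := fun h' => h (T_inj T hT z h')
    rw [geom_sum_eq h1, ← map_pow, FiniteField.pow_card_sub_one_eq_one z h0]
    simp

lemma T_half (h2 : ringChar F ≠ 2) (T : MulChar F ℂ)
    (hT : ∀ χ : MulChar F ℂ, ∃ n : ℕ, χ = T ^ n) (m : ℕ) (hm : Fintype.card F = 6 * m + 1) (x : F) :
    (T ^ (3 * m)) x = ph x := by
  by_cases h0 : x = 0
  · subst h0; simp [ph, T_zero]
  rw [T_pow T _ x h0, ph, quadraticChar_eq_pow_of_char_ne_two h2 h0,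
    show Fintype.card F / 2 = 3 * m by omega, ← map_pow]
  have hsq : (x ^ (3 * m)) ^ 2 = 1 := by
    rw [← pow_mul, ← FiniteField.pow_card_sub_one_eq_one x h0]; congr 1; omega
  split_ifs with h
  · simp [h]
  · have h' : T (x ^ (3 * m)) ≠ 1 := fun h' => h (T_inj T hT _ h')
    have : T (x ^ (3 * m)) ^ 2 = 1 := by rw [← map_pow, hsq, map_one]
    rw [sq] at this
    rcases mul_self_eq_one_iff.1 this with h1 | h1
    · exact absurd h1 h'
    · simp [h1]

lemma exists_zeta (m : ℕ) (hm : Fintype.card F = 6 * m + 1) : ∃ ζ : F, IsPrimitiveRoot ζ 3 := by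
  obtain ⟨g, hg⟩ := IsCyclic.exists_generator (α := Fˣ)
  have ho : orderOf g = 6 * m := by
    rw [orderOf_eq_card_of_forall_mem_zpowers hg, Nat.card_eq_fintype_card, Fintype.card_units]; omega
  have hm0 : 0 < m := by
    have := Fintype.one_lt_card (α := F); omega
  have : IsPrimitiveRoot g (6 * m) := ho ▸ IsPrimitiveRoot.orderOf g
  have h3 := this.pow (a := 2 * m) (b := 3) (by omega) (by ring)
  exact ⟨((g ^ (2 * m) : Fˣ) : F), IsPrimitiveRoot.coe_units_iff.2 h3⟩

lemma cube_of_pow (m : ℕ) (hm : Fintype.card F = 6 * m + 1) (u : F) (hu : u ≠ 0)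
    (h : u ^ (4 * m) = 1) : ∃ v : F, v ^ 3 = u := by
  obtain ⟨g, hg⟩ := IsCyclic.exists_monoid_generator (α := Fˣ)
  have ho : orderOf g = 6 * m := by
    rw [orderOf_eq_card_of_forall_mem_powers hg, Nat.card_eq_fintype_card, Fintype.card_units]; omega
  have hm0 : 0 < m := by
    have := Fintype.one_lt_card (α := F); omega
  obtain ⟨j, hj⟩ := Submonoid.mem_powers_iff _ _ |>.1 (hg (Units.mk0 u hu))
  have h1 : g ^ (j * (4 * m)) = 1 := by
    rw [pow_mul, hj]; ext; simpa using h
  have h3 := orderOf_dvd_of_pow_eq_one h1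
  rw [ho] at h3
  have : 3 ∣ 2 * j := by
    have h4 : (2 * m) * 3 ∣ (2 * m) * (2 * j) := by convert h3 using 1 <;> ring
    exact Nat.dvd_of_mul_dvd_mul_left (by omega) h4
  obtain ⟨i, rfl⟩ : 3 ∣ j := by omega
  refine ⟨((g ^ i : Fˣ) : F), ?_⟩
  have := congrArg (Units.val) hj
  rw [← Units.val_pow_eq_pow_val, ← pow_mul, mul_comm, this]; rfl

lemma cube_count (T : MulChar F ℂ)
    (hT : ∀ χ : MulChar F ℂ, ∃ n : ℕ, χ = T ^ n) (m : ℕ) (hm : Fintype.card F = 6 * m + 1)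
    (u : F) (hu : u ≠ 0) :
    ((univ.filter (fun v : F => v ^ 3 = u)).card : ℂ)
      = 1 + (T ^ (4 * m)) u + (T ^ (4 * m)) u⁻¹ := by
  obtain ⟨ζ, hζ⟩ := exists_zeta m hm
  have hc : (univ.filter (fun v : F => v ^ 3 = u)).card = if ∃ α, α ^ 3 = u then 3 else 0 := by
    have hr := hζ.card_nthRoots u
    rw [← Multiset.toFinset_card_of_nodup (hζ.nthRoots_nodup hu)] at hr
    rw [show (if ∃ α, α ^ 3 = u then 3 else 0) = (Polynomial.nthRoots 3 u).toFinset.card by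
      rw [hr]; congr]
    congr 1
    ext v
    simp [Polynomial.mem_nthRoots]
  rw [hc, T_pow T _ u hu, T_pow T _ _ (inv_ne_zero hu)]
  have hw3 : (T u ^ (4 * m)) ^ 3 = 1 := by
    rw [← map_pow, ← map_pow, ← pow_mul, show 4 * m * 3 = (Fintype.card F - 1) * 2 by omega, pow_mul,
      FiniteField.pow_card_sub_one_eq_one u hu]
    simp
  have hwi : T u ^ (4 * m) * T u⁻¹ ^ (4 * m) = 1 := by
    rw [← mul_pow, ← map_mul, mul_inv_cancel₀ hu]; simp
  generalize hA : T u ^ (4 * m) = A at *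
  generalize T u⁻¹ ^ (4 * m) = B at *
  split_ifs with h
  · obtain ⟨v, rfl⟩ := h
    have hv : v ≠ 0 := by rintro rfl; simp at hu
    have : A = 1 := by
      rw [← hA, ← map_pow, ← pow_mul, show 3 * (4 * m) = (Fintype.card F - 1) * 2 by omega, pow_mul,
        FiniteField.pow_card_sub_one_eq_one v hv]
      simp
    subst this
    have : B = 1 := by simpa using hwi
    subst this
    norm_num
  · have hA1 : A ≠ 1 := by
      intro h1
      apply h
      apply cube_of_pow m hm u hu
      apply T_inj T hT
      rw [map_pow, hA, h1]
    have hB : B = A ^ 2 := by linear_combination A ^ 2 * hwi - B * hw3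
    have : (A - 1) * (1 + A + A ^ 2) = 0 := by linear_combination hw3
    rcases mul_eq_zero.1 this with h1 | h1
    · exact absurd (sub_eq_zero.1 h1) hA1
    · rw [hB, h1]; simp

lemma omega_sum (h2 : ringChar F ≠ 2) (T : MulChar F ℂ)
    (hT : ∀ χ : MulChar F ℂ, ∃ n : ℕ, χ = T ^ n) (m : ℕ) (hm : Fintype.card F = 6 * m + 1)
    (g : F → ℂ) :
    ∑ r ∈ univ.filter (fun r : F => r ≠ 0), (T ^ (4 * m)) r * g (r + r⁻¹)
      = ∑ s : F, g (s ^ 3 - 3 * s) - ∑ s : F, g s := by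
  obtain ⟨ζ, hζ⟩ := exists_zeta m hm
  have hζ' : ζ ^ 2 + ζ + 1 = 0 := by
    have h1 : ζ - 1 ≠ 0 := sub_ne_zero.2 (hζ.ne_one (by norm_num))
    apply mul_left_cancel₀ h1
    linear_combination hζ.pow_eq_one
  have e1 : ∑ v ∈ univ.filter (fun r : F => r ≠ 0), g (v ^ 3 + (v ^ 3)⁻¹)
      = ∑ u ∈ univ.filter (fun r : F => r ≠ 0),
        (1 + (T ^ (4 * m)) u + (T ^ (4 * m)) u⁻¹) * g (u + u⁻¹) := by
    rw [← Finset.sum_fiberwise_of_maps_to (t := univ.filter (fun r : F => r ≠ 0))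
      (g := fun v : F => v ^ 3) (by intro v hv; simpa using hv)]
    refine Finset.sum_congr rfl fun u hu => ?_
    have hu0 : u ≠ 0 := by simpa using hu
    rw [Finset.sum_congr rfl (g := fun _ => g (u + u⁻¹)) (by
      intro v hv; rw [(mem_filter.1 hv).2])]
    rw [Finset.sum_const, nsmul_eq_mul, ← cube_count T hT m hm u hu0]
    congr 3
    ext v
    simp only [mem_filter, mem_univ, true_and]
    constructor
    · exact fun h => h.2
    · intro h
      refine ⟨?_, h⟩
      rintro rfl
      apply hu0; rw [← h]; simp
  have e2 : ∑ u ∈ univ.filter (fun r : F => r ≠ 0), (T ^ (4 * m)) u⁻¹ * g (u + u⁻¹)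
      = ∑ u ∈ univ.filter (fun r : F => r ≠ 0), (T ^ (4 * m)) u * g (u + u⁻¹) := by
    refine Finset.sum_nbij' (fun u => u⁻¹) (fun u => u⁻¹) ?_ ?_ ?_ ?_ ?_
    · intro u hu; simpa using hu
    · intro u hu; simpa using hu
    · intro u _; simp
    · intro u _; simp
    · intro u _; simp [add_comm]
  have e3 : ∑ v ∈ univ.filter (fun r : F => r ≠ 0), g (v ^ 3 + (v ^ 3)⁻¹)
      = ∑ v ∈ univ.filter (fun r : F => r ≠ 0), (fun s => g (s ^ 3 - 3 * s)) (v + v⁻¹) := by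
    refine Finset.sum_congr rfl fun v hv => ?_
    have hv0 : v ≠ 0 := by simpa using hv
    show _ = g _
    congr 1
    field_simp
    ring
  rw [e3, sum_add_inv h2 (fun s => g (s ^ 3 - 3 * s))] at e1
  simp only [add_mul, one_mul, Finset.sum_add_distrib, e2] at e1
  rw [sum_add_inv h2 g] at e1
  have c := cheb h2 ζ hζ' g
  simp only [mul_add, mul_sub, mul_one, Finset.sum_add_distrib, Finset.sum_sub_distrib] at e1 c
  linear_combination (-1/2) * e1 - (1/2) * c

lemma hyp_eq1 (T A B : MulChar F ℂ) (hT : ∀ χ : MulChar F ℂ, ∃ n : ℕ, χ = T ^ n) (t : F) :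
    (Fintype.card F : ℂ) * hyp2F1 T A B 1 t
      = ∑ x : F, ∑ y : F, A x * B y *
        (if x * y * t * (1 - x)⁻¹ * (1 - y)⁻¹ = 1 then 1 else 0) := by
  have hq0 : (Fintype.card F : ℂ) ≠ 0 := by exact_mod_cast Fintype.card_ne_zero
  have hq1 : (Fintype.card F : ℂ) - 1 ≠ 0 := by
    have := Fintype.one_lt_card (α := F)
    rw [sub_ne_zero]; exact_mod_cast this.ne'
  have term : ∀ n : ℕ, greeneBinom F (A * T ^ n) (T ^ n) * greeneBinom F (B * T ^ n) (1 * T ^ n)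
      * (T ^ n) t = 1 / (Fintype.card F : ℂ) ^ 2 * ∑ x : F, ∑ y : F, A x * B y *
        (T ^ n) (x * y * t * (1 - x)⁻¹ * (1 - y)⁻¹) := by
    intro n
    have hneg : (T ^ n) (-1) * (T ^ n) (-1) = 1 := by
      rw [← map_mul]; simp
    simp only [greeneBinom, one_mul, MulChar.inv_apply', MulChar.mul_apply]
    rw [show ∀ a b c d e : ℂ, a / b * c * (a / b * d) * e = (a * a) * (1 / b ^ 2 * (c * d * e)) by
      intros; ring, hneg, one_mul, Finset.sum_mul_sum, Finset.sum_mul]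
    congr 1
    refine Finset.sum_congr rfl fun x _ => ?_
    rw [Finset.sum_mul]
    refine Finset.sum_congr rfl fun y _ => ?_
    simp only [map_mul]
    ring
  rw [hyp2F1]
  simp only [term]
  rw [← Finset.mul_sum, Finset.sum_comm]
  rw [show ∀ S : ℂ, (Fintype.card F : ℂ) * ((Fintype.card F : ℂ) / ((Fintype.card F : ℂ) - 1) *
    (1 / (Fintype.card F : ℂ) ^ 2 * S)) = S / ((Fintype.card F : ℂ) - 1) by
      intro S; field_simp]
  rw [div_eq_iff hq1, Finset.sum_mul]
  refine Finset.sum_congr rfl fun x _ => ?_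
  rw [Finset.sum_comm, Finset.sum_mul]
  refine Finset.sum_congr rfl fun y _ => ?_
  rw [← Finset.mul_sum, T_orth T hT]
  split_ifs <;> simp

lemma hyp_eq2 (h2 : ringChar F ≠ 2) (T A B : MulChar F ℂ)
    (hT : ∀ χ : MulChar F ℂ, ∃ n : ℕ, χ = T ^ n) (hAB : A * B = 1) (hA : A ≠ 1)
    (t : F) (ht0 : t ≠ 0) (ht1 : t ≠ 1) :
    (Fintype.card F : ℂ) * hyp2F1 T A B 1 t
      = ∑ r ∈ univ.filter (fun r : F => r ≠ 0), A r * ph (r ^ 2 - (2 - 4 * t) * r + 1) := by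
  have h1t : 1 - t ≠ 0 := sub_ne_zero.2 (Ne.symm ht1)
  rw [hyp_eq1 T A B hT, Finset.sum_comm]
  have step : ∀ y : F, (∑ x : F, A x * B y *
        (if x * y * t * (1 - x)⁻¹ * (1 - y)⁻¹ = 1 then (1 : ℂ) else 0))
      = ∑ r : F, A r * (if r * (1 - t) * y ^ 2 + -(1 + r) * y + 1 = 0 then 1 else 0) := by
    intro y
    by_cases hy : y = 0
    · subst hy; simp
    rw [← Equiv.sum_comp (Equiv.mulRight₀ y hy)]
    refine Finset.sum_congr rfl fun r _ => ?_
    by_cases hr : r = 0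
    · subst hr; simp [T_zero]
    have e : A (r * y) * B y = A r := by
      have : (A * B) y = 1 := by rw [hAB, MulChar.one_apply (isUnit_iff_ne_zero.2 hy)]
      rw [MulChar.mul_apply] at this
      rw [map_mul, mul_assoc, this, mul_one]
    simp only [Equiv.mulRight₀_apply, e]
    congr 1
    refine if_congr ?_ rfl rfl
    constructor
    · intro h
      have hx1 : 1 - r * y ≠ 0 := by intro h0; rw [h0] at h; simp at h
      have hy1 : 1 - y ≠ 0 := by intro h0; rw [h0] at h; simp at h
      field_simp at h
      linear_combination -h
    · intro h
      have h' : r * y * y * t = (1 - r * y) * (1 - y) := by linear_combination -h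
      have hne : (1 - r * y) * (1 - y) ≠ 0 := by
        rw [← h']; exact mul_ne_zero (mul_ne_zero (mul_ne_zero hr hy) hy) ht0
      rw [mul_assoc _ _ (1 - y)⁻¹, ← mul_inv, h', mul_inv_cancel₀ hne]
  rw [Finset.sum_congr rfl (fun y _ => step y), Finset.sum_comm]
  have step2 : ∀ r : F, (∑ y : F, A r *
        (if r * (1 - t) * y ^ 2 + -(1 + r) * y + 1 = 0 then (1 : ℂ) else 0))
      = A r + if r ≠ 0 then A r * ph (r ^ 2 - (2 - 4 * t) * r + 1) else 0 := by
    intro r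
    by_cases hr : r = 0
    · subst hr; simp [T_zero]
    rw [← Finset.mul_sum, Finset.sum_boole, quad_count_s16 h2 _ _ _ (mul_ne_zero hr h1t), if_pos hr,
      mul_add, mul_one]
    congr 3
    ring
  rw [Finset.sum_congr rfl (fun r _ => step2 r), Finset.sum_add_distrib,
    MulChar.sum_eq_zero_of_ne_one hA, zero_add, Finset.sum_filter]

lemma hyp_eq3 (h2 : ringChar F ≠ 2) (T : MulChar F ℂ)
    (hT : ∀ χ : MulChar F ℂ, ∃ n : ℕ, χ = T ^ n) (m : ℕ) (hm : Fintype.card F = 6 * m + 1)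
    (t : F) (ht0 : t ≠ 0) (ht1 : t ≠ 1) :
    (Fintype.card F : ℂ) * hyp2F1 T (T ^ m) (T ^ (5 * m)) 1 t
      = ∑ s : F, ph (s ^ 3 - 3 * s - (2 - 4 * t)) := by
  have hT6 : T ^ (6 * m) = 1 := by
    rw [← MulChar.pow_card_eq_one T, Fintype.card_units, hm]; congr 1
  have hm0 : 0 < m := by
    have := Fintype.one_lt_card (α := F); omega
  have hA : T ^ m ≠ 1 := by
    intro h
    have h3 := T_half h2 T hT m hm
    rw [mul_comm, pow_mul, h, one_pow] at h3
    obtain ⟨x, hx⟩ := quadraticChar_exists_neg_one h2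
    have := h3 x
    by_cases hx0 : x = 0
    · subst hx0; simp at hx
    · rw [MulChar.one_apply (isUnit_iff_ne_zero.2 hx0), ph, hx] at this
      norm_num at this
  rw [hyp_eq2 h2 T _ _ hT (by rw [← pow_add, ← hT6]; congr 1; ring) hA t ht0 ht1]
  have e : ∀ r ∈ univ.filter (fun r : F => r ≠ 0),
      (T ^ m) r * ph (r ^ 2 - (2 - 4 * t) * r + 1)
        = (T ^ (4 * m)) r * (fun s : F => ph (s - (2 - 4 * t))) (r + r⁻¹) := by
    intro r hr
    have hr0 : r ≠ 0 := by simpa using hr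
    have h1 : T ^ m = T ^ (4 * m) * T ^ (3 * m) := by
      rw [← pow_add, show 4 * m + 3 * m = 6 * m + m by ring, pow_add, hT6, one_mul]
    rw [h1, MulChar.mul_apply, T_half h2 T hT m hm, mul_assoc, ← ph_mul]
    congr 1
    show _ = ph _
    rw [show r * (r ^ 2 - (2 - 4 * t) * r + 1) = r ^ 2 * (r + r⁻¹ - (2 - 4 * t)) by
      field_simp; ring, ph_mul, ph_sq r hr0, one_mul]
  rw [Finset.sum_congr rfl e, omega_sum h2 T hT m hm (fun s : F => ph (s - (2 - 4 * t)))]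
  have z : ∑ s : F, ph (s - (2 - 4 * t)) = 0 := by
    refine (Equiv.sum_comp (Equiv.subRight (2 - 4 * t)) (fun s : F => ph s)).trans ?_
    have := quadraticChar_sum_zero h2
    simp only [ph]
    exact_mod_cast this
  rw [z, sub_zero]

lemma point_count (h2 : ringChar F ≠ 2) (f : F → F) :
    (Nat.card {s : F × F // s.2 ^ 2 = f s.1} : ℂ) = Fintype.card F + ∑ x : F, ph (f x) := by
  rw [Nat.card_eq_fintype_card, Fintype.card_subtype, Finset.card_filter, Fintype.sum_prod_type]
  push_cast
  simp only [Finset.sum_boole, ph_sqrts h2, Finset.sum_add_distrib]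
  simp [add_comm]

end

theorem stmt16 {p : ℕ} [hp : Fact p.Prime] (hp2 : p ≠ 2) {F : Type*} [Field F] [Fintype F]
    [Algebra (ZMod p) F] (hq : Fintype.card F % 6 = 1) (a b : F) (ha : a ≠ 0)
    (hsq : IsSquare (-a / 3)) (k : F) (hk : 3 * k ^ 2 + a = 0)
    (hns : 4 * a ^ 3 + 27 * b ^ 2 ≠ 0) (T : MulChar F ℂ) (hT : ∀ χ : MulChar F ℂ, ∃ n : ℕ, χ = T ^ n) :
    (Nat.card {s : F × F // s.2 ^ 2 = s.1 ^ 3 + a * s.1 + b} : ℂ) + 1 =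
      (Fintype.card F : ℂ) + 1 + (Fintype.card F : ℂ) * (T ^ ((Fintype.card F - 1) / 2)) (-k) *
        hyp2F1 T (T ^ ((Fintype.card F - 1) / 6)) (T ^ ((5 * (Fintype.card F - 1)) / 6)) 1
          (-(k ^ 3 + a * k + b) / (4 * k ^ 3)) := by
  classical
  obtain ⟨m, hm⟩ : ∃ m, Fintype.card F = 6 * m + 1 := ⟨Fintype.card F / 6, by omega⟩
  have hcast : (6 : F) * m + 1 = 0 := by
    have := FiniteField.cast_card_eq_zero F
    rw [hm] at this; exact_mod_cast this
  have two : (2 : F) ≠ 0 := by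
    intro h; apply one_ne_zero (α := F); linear_combination hcast - 3 * m * h
  have three : (3 : F) ≠ 0 := by
    intro h; apply one_ne_zero (α := F); linear_combination hcast - 2 * m * h
  have h2 : ringChar F ≠ 2 := by
    intro h
    apply two
    have := ringChar.Nat.cast_ringChar (R := F)
    rw [h] at this; exact_mod_cast this
  have hk0 : k ≠ 0 := by
    rintro rfl; apply ha; simpa using hk
  have haa : a = -3 * k ^ 2 := by linear_combination hk
  subst haa
  have four : (4 : F) ≠ 0 := by
    rw [show (4 : F) = 2 * 2 by norm_num]; exact mul_ne_zero two two
  set t : F := -(k ^ 3 + -3 * k ^ 2 * k + b) / (4 * k ^ 3) with ht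
  have ht' : 4 * k ^ 3 * t = 2 * k ^ 3 - b := by
    rw [ht]; field_simp; ring
  have ht0 : t ≠ 0 := by
    intro h; rw [h] at ht'
    apply hns; linear_combination -27 * (2 * k ^ 3 + b) * (-ht')
  have ht1 : t ≠ 1 := by
    intro h; rw [h] at ht'
    apply hns; linear_combination -27 * (2 * k ^ 3 - b) * ht'
  rw [point_count h2 (fun x => x ^ 3 + -3 * k ^ 2 * x + b),
    show (Fintype.card F - 1) / 2 = 3 * m by omega, show (Fintype.card F - 1) / 6 = m by omega,
    show 5 * (Fintype.card F - 1) / 6 = 5 * m by omega, T_half h2 T hT m hm,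
    mul_right_comm, hyp_eq3 h2 T hT m hm t ht0 ht1,
    ← Equiv.sum_comp (Equiv.mulLeft₀ (-k) (neg_ne_zero.2 hk0))]
  rw [Finset.sum_mul, add_right_comm]
  congr 1
  refine Finset.sum_congr rfl fun s _ => ?_
  rw [← ph_mul, ← one_mul (ph (_ * -k)), ← ph_sq k hk0, ← ph_mul]
  congr 1
  simp only [Equiv.mulLeft₀_apply]
  clear_value t
  linear_combination ht'
end
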